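/- arXiv:2207.14034 — 2 statements merged into one kernel-verified Lean document; each statement's English description precedes it below -/
import Mathlib

section
/- Let g be a semisimple real Lie algebra without compact ideals and σ an involutive automorphism of g such that the fixed point algebra g^σ is compactly embedded (i.e., the closure of the subgroup of Aut(g) generated by e^{ad g^σ} is compact). Then σ is a Cartan involution of g. -/
namespace Stmt7

variable {g : Type*} [LieRing g] [LieAlgebra ℝ g] [FiniteDimensional ℝ g]

/-- A subset `s` of a finite-dimensional real Lie algebra `g` is *compactly
embedded* if the group `Inn_g(s) = ⟨e^{ad s}⟩` has compact closure in `Aut(g)`;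
for a finite-dimensional real Lie algebra this is equivalent (by averaging,
resp. by `O(B)` being compact) to the existence of a positive definite
symmetric bilinear form `B` on `g` for which `ad x` is skew-symmetric for all
`x ∈ s`, which is the formulation used here. -/
def CompactlyEmbedded (s : Set g) : Prop :=
  ∃ B : LinearMap.BilinForm ℝ g, B.IsSymm ∧ (∀ x : g, x ≠ 0 → 0 < B x x) ∧
    ∀ x ∈ s, ∀ y z : g, B ⁅x, y⁆ z + B y ⁅x, z⁆ = 0

section Diagonalization

variable {V : Type*} [AddCommGroup V] [Module ℝ V]

/-- A symmetric bilinear form on a finite-dimensional real vector space is diagonal in some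
orthonormal basis of a given positive definite form. -/
theorem exists_orthonormal_basis_diagonal [FiniteDimensional ℝ V] (B F : LinearMap.BilinForm ℝ V)
    (hB : B.IsSymm) (hpos : ∀ x : V, x ≠ 0 → 0 < B x x) (hF : F.IsSymm) :
    ∃ (n : ℕ) (b : Module.Basis (Fin n) ℝ V) (μ : Fin n → ℝ),
      (∀ i j, B (b i) (b j) = if i = j then 1 else 0) ∧
      ∀ i y, F (b i) y = μ i * B (b i) y := by
  have hnd : B.Nondegenerate := by
    constructor <;> intro x hx <;> by_contra h <;> exact (hpos x h).ne' (hx x)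
  let core : InnerProductSpace.Core ℝ V :=
    { inner := fun x y => B x y
      conj_inner_symm := fun x y => hB.eq y x
      re_inner_nonneg := fun x => by
        by_cases h : x = 0
        · simp [h]
        · exact (hpos x h).le
      add_left := fun x y z => by simp
      smul_left := fun x y r => by simp
      definite := fun x hx => by
        by_contra h
        exact (hpos x h).ne' hx }
  let _ : NormedAddCommGroup V := core.toNormedAddCommGroup
  let _ : InnerProductSpace ℝ V := InnerProductSpace.ofCore core.toCore
  have hinner : ∀ x y : V, inner ℝ x y = B x y := fun _ _ => rfl
  let T : V →ₗ[ℝ] V := F.symmCompOfNondegenerate B hnd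
  have hT : ∀ x y, B (T x) y = F x y := fun x y =>
    LinearMap.BilinForm.symmCompOfNondegenerate_left_apply F hnd y x
  have hsymm : T.IsSymmetric := fun x y => by
    rw [hinner, hinner, hT, hF.eq, ← hT, hB.eq]
  refine ⟨_, (hsymm.eigenvectorBasis rfl).toBasis, hsymm.eigenvalues rfl, fun i j => ?_,
    fun i y => ?_⟩
  · rw [← hinner, OrthonormalBasis.coe_toBasis]
    exact orthonormal_iff_ite.mp (hsymm.eigenvectorBasis rfl).orthonormal i j
  · rw [← hT, OrthonormalBasis.coe_toBasis, hsymm.apply_eigenvectorBasis]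
    simp

theorem repr_eq_of_orthonormal {n : ℕ} (B : LinearMap.BilinForm ℝ V) (b : Module.Basis (Fin n) ℝ V)
    (hb : ∀ i j, B (b i) (b j) = if i = j then 1 else 0) (v : V) (i : Fin n) :
    b.repr v i = B v (b i) := by
  have h : B (∑ j, b.repr v j • b j) (b i) = b.repr v i := by
    simp only [map_sum, map_smul, LinearMap.sum_apply, LinearMap.smul_apply, smul_eq_mul, hb]
    simp
  rw [← h, b.sum_repr]

/-- A form which is diagonal with positive entries in an orthonormal basis is positive definite. -/
theorem apply_self_pos_of_diagonal {n : ℕ} (B F : LinearMap.BilinForm ℝ V)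
    (b : Module.Basis (Fin n) ℝ V) (μ : Fin n → ℝ)
    (hb : ∀ i j, B (b i) (b j) = if i = j then 1 else 0)
    (hF : ∀ i y, F (b i) y = μ i * B (b i) y) (hμ : ∀ i, 0 < μ i) (x : V) (hx : x ≠ 0) :
    0 < F x x := by
  have hexp : F x x = ∑ i, μ i * (b.repr x i) ^ 2 := by
    conv_lhs => rw [← b.sum_repr x]
    simp only [map_sum, map_smul, LinearMap.sum_apply, LinearMap.smul_apply, smul_eq_mul, hF, hb]
    simp
    exact Finset.sum_congr rfl fun i _ => by ring
  obtain ⟨i, hi⟩ : ∃ i, b.repr x i ≠ 0 := by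
    by_contra! h
    exact hx (b.ext_elem fun i => by simp [h i])
  rw [hexp]
  exact Finset.sum_pos' (fun j _ => by have := hμ j; positivity)
    ⟨i, Finset.mem_univ i, by have := hμ i; positivity⟩

/-- The trace of the square of an endomorphism which is skew for a positive definite form. -/
theorem trace_sq_nonpos_of_skew [FiniteDimensional ℝ V] (B : LinearMap.BilinForm ℝ V)
    (hB : B.IsSymm) (hpos : ∀ x : V, x ≠ 0 → 0 < B x x) (A : V →ₗ[ℝ] V)
    (hA : ∀ y z, B (A y) z + B y (A z) = 0) :
    LinearMap.trace ℝ V (A ∘ₗ A) ≤ 0 ∧ (LinearMap.trace ℝ V (A ∘ₗ A) = 0 → A = 0) := by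
  obtain ⟨n, b, -, hb, -⟩ := exists_orthonormal_basis_diagonal B B hB hpos hB
  have htr : LinearMap.trace ℝ V (A ∘ₗ A) = -∑ i, B (A (b i)) (A (b i)) := by
    rw [LinearMap.trace_eq_matrix_trace ℝ b, Matrix.trace, ← Finset.sum_neg_distrib]
    refine Finset.sum_congr rfl fun i _ => ?_
    rw [Matrix.diag_apply, LinearMap.toMatrix_apply, repr_eq_of_orthonormal B b hb,
      LinearMap.comp_apply]
    linarith [hA (A (b i)) (b i)]
  have hnonneg : ∀ i ∈ Finset.univ, 0 ≤ B (A (b i)) (A (b i)) := fun i _ => by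
    by_cases h : A (b i) = 0
    · simp [h]
    · exact (hpos _ h).le
  refine ⟨by rw [htr]; linarith [Finset.sum_nonneg hnonneg], fun h => b.ext fun i => ?_⟩
  rw [htr, neg_eq_zero, Finset.sum_eq_zero_iff_of_nonneg hnonneg] at h
  by_contra hne
  exact (hpos _ hne).ne' (h i (Finset.mem_univ i))

end Diagonalization

/-- The Killing form is negative definite on every compactly embedded subset, if the radical of
`g` is trivial. -/
theorem CompactlyEmbedded.killingForm_self_neg [LieAlgebra.HasTrivialRadical ℝ g] {s : Set g}
    (hs : CompactlyEmbedded s) {x : g} (hx : x ∈ s) (hx0 : x ≠ 0) : killingForm ℝ g x x < 0 := by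
  obtain ⟨B, hB, hpos, hskew⟩ := hs
  obtain ⟨hle, hzero⟩ := trace_sq_nonpos_of_skew B hB hpos (LieModule.toEnd ℝ g g x) (hskew x hx)
  rw [LieModule.traceForm_apply_apply]
  refine lt_of_le_of_ne hle fun h => hx0 ?_
  have hcenter : x ∈ LieAlgebra.center ℝ g :=
    (LieModule.mem_maxTrivSubmodule ℝ g g x).mpr fun y => by
    rw [← lie_skew, ← LieModule.toEnd_apply_apply ℝ g g, hzero h, LinearMap.zero_apply, neg_zero]
  rwa [LieAlgebra.center_eq_bot, LieSubmodule.mem_bot] at hcenter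

section Involution

variable (σ : g ≃ₗ⁅ℝ⁆ g)

/-- The form `-κ(x, σ y)`. -/
noncomputable def twistedKillingForm : LinearMap.BilinForm ℝ g :=
  -(killingForm ℝ g).compl₂ (σ : g →ₗ[ℝ] g)

omit [FiniteDimensional ℝ g] in
theorem twistedKillingForm_apply (x y : g) :
    twistedKillingForm σ x y = -killingForm ℝ g x (σ y) := rfl

variable {σ}

omit [FiniteDimensional ℝ g] in
theorem twistedKillingForm_isSymm (hinv : ∀ x : g, σ (σ x) = x) :
    (twistedKillingForm σ).IsSymm := ⟨fun x y => by
  rw [twistedKillingForm_apply, twistedKillingForm_apply,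
    ← LieAlgebra.killingForm_of_equiv_apply σ, hinv, LieModule.traceForm_comm]⟩

omit [FiniteDimensional ℝ g] in
theorem twistedKillingForm_apply_equiv (x y : g) :
    twistedKillingForm σ (σ x) (σ y) = twistedKillingForm σ x y := by
  simp only [twistedKillingForm_apply, LieAlgebra.killingForm_of_equiv_apply]

omit [FiniteDimensional ℝ g] in
theorem twistedKillingForm_lie {z : g} (hz : σ z = z) (x y : g) :
    twistedKillingForm σ ⁅z, x⁆ y = -twistedKillingForm σ x ⁅z, y⁆ := by
  rw [twistedKillingForm_apply, twistedKillingForm_apply, LieEquiv.map_lie, hz, neg_neg,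
    LieModule.traceForm_apply_lie_apply' ℝ g g z x (σ y), neg_neg]

omit [FiniteDimensional ℝ g] in
/-- Averaging over the group generated by an involution. -/
theorem exists_invariant_form (hinv : ∀ x : g, σ (σ x) = x)
    (hce : CompactlyEmbedded {x : g | σ x = x}) :
    ∃ B : LinearMap.BilinForm ℝ g, B.IsSymm ∧ (∀ x : g, x ≠ 0 → 0 < B x x) ∧
      (∀ x, σ x = x → ∀ y z : g, B ⁅x, y⁆ z = -B y ⁅x, z⁆) ∧
      ∀ x y, B (σ x) (σ y) = B x y := by
  obtain ⟨B, hB, hpos, hskew⟩ := hce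
  refine ⟨B + B.compl₁₂ (σ : g →ₗ[ℝ] g) (σ : g →ₗ[ℝ] g), ⟨fun x y => ?_⟩, fun x hx => ?_,
    fun x hx y z => ?_, fun x y => ?_⟩
  · have h₁ := hB.eq x y
    have h₂ := hB.eq (σ x) (σ y)
    simp_all
  · have h₁ := hpos x hx
    have h₂ := hpos (σ x) (fun h => hx (by rw [← hinv x, h, map_zero]))
    simpa using add_pos h₁ h₂
  · have h₁ := hskew x hx y z
    have h₂ := hskew x hx (σ y) (σ z)
    have hσ : ∀ w, σ ⁅x, w⁆ = ⁅x, σ w⁆ := fun w => by rw [LieEquiv.map_lie, hx]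
    change B ⁅x, y⁆ z + B (σ ⁅x, y⁆) (σ z) = -(B y ⁅x, z⁆ + B (σ y) (σ ⁅x, z⁆))
    rw [hσ, hσ]
    linarith
  · simp [hinv, add_comm]

variable {B : LinearMap.BilinForm ℝ g} {l m : ℝ}

/-- The eigenspace for `l` of `-κ(x, σ y)` relative to a reference form `B`. -/
noncomputable def relEigenspace (σ : g ≃ₗ⁅ℝ⁆ g) (B : LinearMap.BilinForm ℝ g) (l : ℝ) :
    Submodule ℝ g :=
  LinearMap.ker (twistedKillingForm σ - l • B)

omit [FiniteDimensional ℝ g] in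
theorem mem_relEigenspace {x : g} :
    x ∈ relEigenspace σ B l ↔ ∀ y, twistedKillingForm σ x y = l * B x y := by
  simp [relEigenspace, LinearMap.ext_iff, sub_eq_zero]

omit [FiniteDimensional ℝ g] in
theorem relEigenspace_lie (hBk : ∀ x, σ x = x → ∀ y z : g, B ⁅x, y⁆ z = -B y ⁅x, z⁆) {z x : g}
    (hz : σ z = z) (hx : x ∈ relEigenspace σ B l) : ⁅z, x⁆ ∈ relEigenspace σ B l := by
  rw [mem_relEigenspace] at *
  intro y
  rw [twistedKillingForm_lie hz, hx, hBk z hz]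
  ring

omit [FiniteDimensional ℝ g] in
theorem relEigenspace_equiv (hinv : ∀ x : g, σ (σ x) = x)
    (hBσ : ∀ x y, B (σ x) (σ y) = B x y) {x : g}
    (hx : x ∈ relEigenspace σ B l) : σ x ∈ relEigenspace σ B l := by
  rw [mem_relEigenspace] at *
  intro y
  rw [← hinv y, twistedKillingForm_apply_equiv, hBσ, hx]

omit [FiniteDimensional ℝ g] in
theorem equiv_lie_eq_self {x y : g} (hx : σ x = -x) (hy : σ y = -y) : σ ⁅x, y⁆ = ⁅x, y⁆ := by
  rw [LieEquiv.map_lie, hx, hy, neg_lie, lie_neg, neg_neg]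

omit [FiniteDimensional ℝ g] in
theorem equiv_lie_eq_neg {x y : g} (hx : σ x = x) (hy : σ y = -y) : σ ⁅x, y⁆ = -⁅x, y⁆ := by
  rw [LieEquiv.map_lie, hx, hy, lie_neg]

omit [FiniteDimensional ℝ g] in
theorem killingForm_eq_zero_of_equiv {x y : g} (hx : σ x = -x) (hy : σ y = y) :
    killingForm ℝ g x y = 0 := by
  have h := LieAlgebra.killingForm_of_equiv_apply σ x y
  rw [hx, hy, map_neg, LinearMap.neg_apply] at h
  linarith

section Nonpos

variable [LieAlgebra.HasTrivialRadical ℝ g] (hinv : ∀ x : g, σ (σ x) = x)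
    (hce : CompactlyEmbedded {x : g | σ x = x}) (hB : B.IsSymm)
    (hpos : ∀ x : g, x ≠ 0 → 0 < B x x)
    (hBk : ∀ x, σ x = x → ∀ y z : g, B ⁅x, y⁆ z = -B y ⁅x, z⁆)
    (hBσ : ∀ x y, B (σ x) (σ y) = B x y)

include hinv hce hpos hBσ in
theorem equiv_eq_neg_of_mem_relEigenspace (hl : l ≤ 0) {x : g} (hx : x ∈ relEigenspace σ B l) :
    σ x = -x := by
  have hu : x + σ x ∈ relEigenspace σ B l := add_mem hx (relEigenspace_equiv hinv hBσ hx)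
  have hfix : σ (x + σ x) = x + σ x := by rw [map_add, hinv, add_comm]
  by_contra hne
  have h0 : x + σ x ≠ 0 := fun h => hne (eq_neg_of_add_eq_zero_right h)
  have h₁ := hce.killingForm_self_neg (x := x + σ x) hfix h0
  have h₂ := mem_relEigenspace.mp hu (x + σ x)
  rw [twistedKillingForm_apply, hfix] at h₂
  nlinarith [hpos _ h0]

include hinv hce hB hBk in
theorem lie_eq_zero_of_mem_relEigenspace (hlm : l ≠ m) {x y : g} (hx : x ∈ relEigenspace σ B l)
    (hy : y ∈ relEigenspace σ B m) (hxp : σ x = -x) (hyp : σ y = -y) : ⁅x, y⁆ = 0 := by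
  by_contra hne
  have hk := equiv_lie_eq_self hxp hyp
  refine (hce.killingForm_self_neg (x := ⁅x, y⁆) hk hne).ne ?_
  have hw : ⁅⁅x, y⁆, y⁆ ∈ relEigenspace σ B m := relEigenspace_lie hBk hk hy
  have h₁ := mem_relEigenspace.mp hx ⁅⁅x, y⁆, y⁆
  have h₂ := mem_relEigenspace.mp hw x
  have h₃ := (twistedKillingForm_isSymm hinv).eq x ⁅⁅x, y⁆, y⁆
  have h₄ := hB.eq x ⁅⁅x, y⁆, y⁆
  have h₅ : B x ⁅⁅x, y⁆, y⁆ = 0 := by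
    have : (l - m) * B x ⁅⁅x, y⁆, y⁆ = 0 := by
      rw [← h₄] at h₂
      linarith
    exact (mul_eq_zero.mp this).resolve_left (sub_ne_zero.mpr hlm)
  rw [h₅, mul_zero, twistedKillingForm_apply, equiv_lie_eq_neg hk hyp, map_neg, neg_neg] at h₁
  rw [LieModule.traceForm_apply_lie_apply, ← lie_skew, map_neg, h₁, neg_zero]

include hinv hce hpos hBσ in
theorem relEigenspace_zero_eq_bot : relEigenspace σ B 0 = ⊥ := by
  have hmem : ∀ x, x ∈ relEigenspace σ B 0 ↔ ∀ y, killingForm ℝ g x y = 0 := fun x => by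
    rw [mem_relEigenspace]
    refine ⟨fun h y => ?_, fun h y => by simp [twistedKillingForm_apply, h]⟩
    have := h (σ y)
    rw [twistedKillingForm_apply, hinv] at this
    linarith
  let I : LieIdeal ℝ g :=
    { relEigenspace σ B 0 with
      lie_mem := fun {z x} hx => (hmem _).mpr fun y => by
        rw [LieModule.traceForm_apply_lie_apply', (hmem x).mp hx, neg_zero] }
  have hIab : IsLieAbelian I := by
    refine ⟨fun x y => Subtype.ext ?_⟩
    have hneg : ∀ z : I, σ z = -(z : g) := fun z =>
      equiv_eq_neg_of_mem_relEigenspace hinv hce hpos hBσ le_rfl z.2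
    have hxy : ⁅(x : g), (y : g)⁆ ∈ relEigenspace σ B 0 := lie_mem_right ℝ g I _ _ y.2
    by_contra hne
    exact (hce.killingForm_self_neg (x := ⁅(x : g), (y : g)⁆)
      (equiv_lie_eq_self (hneg x) (hneg y)) hne).ne ((hmem _).mp hxy _)
  have hI : I = ⊥ :=
    (LieAlgebra.hasTrivialRadical_iff_no_abelian_ideals ℝ g).mp inferInstance I hIab
  exact congrArg LieSubmodule.toSubmodule hI

/-- The span of all brackets of two elements of `E`, together with `E`. -/
def bracketClosure (E : Submodule ℝ g) : Submodule ℝ g :=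
  E ⊔ Submodule.span ℝ {w | ∃ x ∈ E, ∃ y ∈ E, ⁅x, y⁆ = w}

omit [FiniteDimensional ℝ g] [LieAlgebra.HasTrivialRadical ℝ g] in
theorem lie_mem_bracketClosure {E : Submodule ℝ g} {z : g}
    (hE : ∀ x ∈ E, ⁅z, x⁆ ∈ bracketClosure E)
    (hEE : ∀ x ∈ E, ∀ y ∈ E, ⁅z, ⁅x, y⁆⁆ ∈ bracketClosure E) {x : g}
    (hx : x ∈ bracketClosure E) : ⁅z, x⁆ ∈ bracketClosure E := by
  have h : bracketClosure E ≤ (bracketClosure E).comap (LieModule.toEnd ℝ g g z) := by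
    refine sup_le hE (Submodule.span_le.mpr ?_)
    rintro _ ⟨x, hx, y, hy, rfl⟩
    exact hEE x hx y hy
  exact h hx

include hinv hce hB hpos hBk hBσ in
theorem relEigenspace_eq_bot_of_neg
    (hnc : ∀ I : LieIdeal ℝ g, (∀ x ∈ I, x ≠ 0 → killingForm ℝ g x x < 0) → I = ⊥)
    {n : ℕ} (b : Module.Basis (Fin n) ℝ g) (μ : Fin n → ℝ)
    (hb : ∀ i, b i ∈ relEigenspace σ B (μ i)) (hl : l < 0) : relEigenspace σ B l = ⊥ := by
  set E := relEigenspace σ B l with hE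
  have hEneg : ∀ x ∈ E, σ x = -x := fun x hx =>
    equiv_eq_neg_of_mem_relEigenspace hinv hce hpos hBσ hl.le hx
  have hbr : ∀ x ∈ E, ∀ y ∈ E, ⁅x, y⁆ ∈ bracketClosure E := fun x hx y hy =>
    Submodule.mem_sup_right (Submodule.subset_span ⟨x, hx, y, hy, rfl⟩)
  have hfix : ∀ z, σ z = z → ∀ x ∈ bracketClosure E, ⁅z, x⁆ ∈ bracketClosure E := by
    intro z hz x hx
    refine lie_mem_bracketClosure
      (fun x hx => Submodule.mem_sup_left (relEigenspace_lie hBk hz hx)) (fun x hx y hy => ?_) hx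
    rw [leibniz_lie]
    exact add_mem (hbr _ (relEigenspace_lie hBk hz hx) _ hy)
      (hbr _ hx _ (relEigenspace_lie hBk hz hy))
  have hanti : ∀ m, ∀ z ∈ relEigenspace σ B m, σ z = -z → ∀ x ∈ bracketClosure E,
      ⁅z, x⁆ ∈ bracketClosure E := by
    intro m z hz hzp x hx
    by_cases hm : m = l
    · subst hm
      refine lie_mem_bracketClosure (hbr z hz) (fun x hx y hy => ?_) hx
      rw [← lie_skew]
      exact neg_mem (Submodule.mem_sup_left
        (relEigenspace_lie hBk (equiv_lie_eq_self (hEneg x hx) (hEneg y hy)) hz))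
    · have hzero : ∀ y ∈ E, ⁅z, y⁆ = 0 := fun y hy =>
        lie_eq_zero_of_mem_relEigenspace hinv hce hB hBk hm hz hy hzp (hEneg y hy)
      refine lie_mem_bracketClosure (fun y hy => ?_) (fun x hx y hy => ?_) hx
      · rw [hzero y hy]
        exact zero_mem _
      · rw [leibniz_lie, hzero x hx, hzero y hy, zero_lie, lie_zero, add_zero]
        exact zero_mem _
  have hall : ∀ z x : g, x ∈ bracketClosure E → ⁅z, x⁆ ∈ bracketClosure E := by
    intro z x hx
    rw [← b.sum_repr z, sum_lie]
    refine sum_mem fun i _ => ?_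
    rw [smul_lie]
    refine Submodule.smul_mem _ _ ?_
    have hσ := relEigenspace_equiv hinv hBσ (hb i)
    have hsplit : b i = (2⁻¹ : ℝ) • (b i + σ (b i)) + (2⁻¹ : ℝ) • (b i - σ (b i)) := by module
    rw [hsplit, add_lie, smul_lie, smul_lie]
    refine add_mem (Submodule.smul_mem _ _ (hfix _ ?_ x hx))
      (Submodule.smul_mem _ _ (hanti (μ i) _ (sub_mem (hb i) hσ) ?_ x hx))
    · rw [map_add, hinv, add_comm]
    · rw [map_sub, hinv, neg_sub]
  let I : LieIdeal ℝ g := { bracketClosure E with lie_mem := fun {z x} hx => hall z x hx }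
  have hI : I = ⊥ := by
    refine hnc I fun x hx hx0 => ?_
    obtain ⟨e, he, w, hw, rfl⟩ := Submodule.mem_sup.mp (show x ∈ bracketClosure E from hx)
    have hwk : σ w = w := by
      have hle : Submodule.span ℝ {w | ∃ x ∈ E, ∃ y ∈ E, ⁅x, y⁆ = w} ≤
          LinearMap.eqLocus (σ : g →ₗ[ℝ] g) LinearMap.id := by
        refine Submodule.span_le.mpr ?_
        rintro _ ⟨x, hx, y, hy, rfl⟩
        exact equiv_lie_eq_self (hEneg x hx) (hEneg y hy)
      exact hle hw
    have h₀ := killingForm_eq_zero_of_equiv (hEneg e he) hwk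
    have h₀' : killingForm ℝ g w e = 0 := by rw [LieModule.traceForm_comm, h₀]
    have h₁ : killingForm ℝ g e e = l * B e e := by
      rw [← mem_relEigenspace.mp he e, twistedKillingForm_apply, hEneg e he, map_neg, neg_neg]
    have hexp : killingForm ℝ g (e + w) (e + w) = l * B e e + killingForm ℝ g w w := by
      simp only [map_add, LinearMap.add_apply, h₀, h₀', h₁]
      ring
    rw [hexp]
    by_cases he0 : e = 0
    · have hw0 : w ≠ 0 := fun h => hx0 (by rw [he0, h, add_zero])
      have := hce.killingForm_self_neg (x := w) hwk hw0
      simpa [he0] using this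
    · have h₂ := mul_neg_of_neg_of_pos hl (hpos e he0)
      by_cases hw0 : w = 0
      · simpa [hw0] using h₂
      · linarith [hce.killingForm_self_neg (x := w) hwk hw0]
  have hle : bracketClosure E = ⊥ := congrArg LieSubmodule.toSubmodule hI
  exact le_bot_iff.mp (hle ▸ le_sup_left)

end Nonpos

end Involution

/-- Let `g` be a real semisimple Lie algebra without compact
ideals (no nonzero ideal on which the Killing form is negative definite) and
`σ` an involutive automorphism of `g` whose fixed point algebra `g^σ` is
compactly embedded.  Then `σ` is a Cartan involution of `g`: the bilinear form
`-κ(x, σ y)` is positive definite (`κ` the Killing form), and the fixed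
algebra `g^σ` is maximal compactly embedded. -/
theorem cartan_involution_of_compactly_embedded_fixed_algebra
    [LieAlgebra.IsSemisimple ℝ g]
    (hnc : ∀ I : LieIdeal ℝ g,
      (∀ x ∈ I, x ≠ 0 → killingForm ℝ g x x < 0) → I = ⊥)
    (σ : g ≃ₗ⁅ℝ⁆ g) (hinv : ∀ x : g, σ (σ x) = x)
    (hce : CompactlyEmbedded {x : g | σ x = x}) :
    (∀ x : g, x ≠ 0 → 0 < -(killingForm ℝ g x (σ x))) ∧
    (∀ s : LieSubalgebra ℝ g, CompactlyEmbedded (s : Set g) →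
      {x : g | σ x = x} ⊆ (s : Set g) → (s : Set g) = {x : g | σ x = x}) := by
  have hposdef : ∀ x : g, x ≠ 0 → 0 < -(killingForm ℝ g x (σ x)) := by
    obtain ⟨B, hB, hpos, hBk, hBσ⟩ := exists_invariant_form hinv hce
    obtain ⟨n, b, μ, hb, hF⟩ := exists_orthonormal_basis_diagonal B (twistedKillingForm σ) hB hpos
      (twistedKillingForm_isSymm hinv)
    have hmem : ∀ i, b i ∈ relEigenspace σ B (μ i) := fun i => mem_relEigenspace.mpr (hF i)
    refine apply_self_pos_of_diagonal B (twistedKillingForm σ) b μ hb hF fun i => ?_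
    by_contra! hle
    have hbot : relEigenspace σ B (μ i) = ⊥ := by
      rcases hle.lt_or_eq with h | h
      · exact relEigenspace_eq_bot_of_neg hinv hce hB hpos hBk hBσ hnc b μ hmem h
      · rw [h]
        exact relEigenspace_zero_eq_bot hinv hce hpos hBσ
    exact b.ne_zero i ((Submodule.mem_bot ℝ).mp (hbot ▸ hmem i))
  refine ⟨hposdef, fun s hs hsub => Set.Subset.antisymm (fun x hx => ?_) hsub⟩
  have hfix : x + σ x ∈ s := hsub (show σ (x + σ x) = x + σ x by rw [map_add, hinv, add_comm])
  have hu : x - σ x ∈ s := by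
    have h : x - σ x = (2 : ℝ) • x - (x + σ x) := by module
    rw [h]
    exact sub_mem (s.smul_mem 2 hx) hfix
  by_contra hne
  have hu0 : x - σ x ≠ 0 := fun h => hne (sub_eq_zero.mp h).symm
  have h₁ := hs.killingForm_self_neg hu hu0
  have h₂ := hposdef _ hu0
  have hσ : σ (x - σ x) = -(x - σ x) := by rw [map_sub, hinv, neg_sub]
  rw [hσ, map_neg, neg_neg] at h₂
  exact lt_asymm h₁ h₂

end Stmt7
end

section
/- For the group G* = SO*(4r) = {g ∈ SU_{2r,2r}(ℂ) : gᵀAg = A} with A = [[0,1],[1,0]] (block form), maximal compact subgroup K* ≅ U_{2r}(ℂ) realized as block matrices diag(a, a^{−⊤}), and the Euler element h = (1/2)[[0,J],[−J,0]] with J = [[0,−1],[1,0]] ∈ Skew_{2r}(ℂ), an element diag(a, a^{−⊤}) with a ∈ U_{2r}(ℂ) commutes with h if and only if aJ = J·conj(a); the set of such a is the subgroup U_r(ℍ) ⊆ U_{2r}(ℂ), which is connected. Hence (K*)^h ≅ U_r(ℍ) is connected. -/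
namespace Stmt19

variable (r : ℕ)

/-- The index type for `2r × 2r` matrices, in `r + r` block form. -/
abbrev ι (r : ℕ) : Type := Fin r ⊕ Fin r

/-- `J = [[0,−1],[1,0]] ∈ Skew_{2r}(ℂ)` (in `r × r` blocks). -/
noncomputable def J (r : ℕ) : Matrix (ι r) (ι r) ℂ :=
  Matrix.fromBlocks 0 (-1) 1 0

/-- The Euler element `h = (1/2)·[[0,J],[−J,0]]` of `so*(4r)`. -/
noncomputable def hEuler (r : ℕ) : Matrix (ι r ⊕ ι r) (ι r ⊕ ι r) ℂ :=
  (1 / 2 : ℂ) • Matrix.fromBlocks 0 (J r) (-(J r)) 0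

/-- Entrywise complex conjugation of a matrix. -/
noncomputable def mconj {m k : Type*} (a : Matrix m k ℂ) : Matrix m k ℂ :=
  a.map (starRingEnd ℂ)

section QuaternionicUnitary

open Matrix

@[simp] lemma mconj_apply {m k : Type*} (a : Matrix m k ℂ) (i : m) (j : k) :
    mconj a i j = starRingEnd ℂ (a i j) := rfl

@[simp] lemma mconj_mconj {m k : Type*} (a : Matrix m k ℂ) : mconj (mconj a) = a := by
  ext; simp

lemma mconj_mul {m n k : Type*} [Fintype n] (a : Matrix m n ℂ) (b : Matrix n k ℂ) :
    mconj (a * b) = mconj a * mconj b := Matrix.map_mul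

lemma mconj_J : mconj (J r) = J r := by
  ext (i | i) (j | j) <;> simp [J, Matrix.one_apply, apply_ite]

lemma J_mul_J : J r * J r = -1 := by
  simp [J, Matrix.fromBlocks_multiply, ← Matrix.fromBlocks_one, Matrix.fromBlocks_neg]

lemma J_transpose : (J r)ᵀ = -J r := by
  simp [J, Matrix.fromBlocks_transpose, Matrix.fromBlocks_neg]

lemma commute_J_iff_fromBlocks (a : Matrix (ι r) (ι r) ℂ) :
    a * J r = J r * mconj a ↔
      ∃ α β : Matrix (Fin r) (Fin r) ℂ, a = fromBlocks α β (-(mconj β)) (mconj α) := by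
  have key (p q s t : Matrix (Fin r) (Fin r) ℂ) :
      fromBlocks p q s t * J r = J r * mconj (fromBlocks p q s t) ↔
        s = -mconj q ∧ t = mconj p := by
    have : mconj (fromBlocks p q s t) = fromBlocks (mconj p) (mconj q) (mconj s) (mconj t) :=
      fromBlocks_map ..
    rw [this]
    simp only [J, fromBlocks_multiply, fromBlocks_inj]
    simp only [mul_zero, mul_one, zero_mul, one_mul, mul_neg, neg_mul, zero_add, add_zero, neg_inj]
    constructor
    · rintro ⟨-, -, h1, h2⟩
      exact ⟨by rw [← h2, neg_neg], h1⟩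
    · rintro ⟨rfl, rfl⟩
      refine ⟨?_, ?_, rfl, by simp⟩ <;> ext <;> simp
  constructor
  · intro h
    obtain ⟨p, q, s, t, rfl⟩ : ∃ p q s t, a = fromBlocks p q s t :=
      ⟨_, _, _, _, (fromBlocks_toBlocks a).symm⟩
    obtain ⟨rfl, rfl⟩ := (key p q s t).1 h
    exact ⟨p, q, rfl⟩
  · rintro ⟨α, β, rfl⟩
    exact (key ..).2 ⟨rfl, rfl⟩

lemma inv_transpose_of_mem_unitaryGroup {n : Type*} [Fintype n] [DecidableEq n]
    {a : Matrix n n ℂ} (ha : a ∈ unitaryGroup n ℂ) : (a⁻¹)ᵀ = mconj a := by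
  rw [Matrix.inv_eq_left_inv (mem_unitaryGroup_iff'.1 ha)]
  ext; simp [star_eq_conjTranspose]

lemma commute_hEuler_iff {a : Matrix (ι r) (ι r) ℂ} (ha : a ∈ unitaryGroup (ι r) ℂ) :
    fromBlocks a 0 0 (a⁻¹)ᵀ * hEuler r = hEuler r * fromBlocks a 0 0 (a⁻¹)ᵀ ↔
      a * J r = J r * mconj a := by
  rw [inv_transpose_of_mem_unitaryGroup ha, hEuler, Matrix.mul_smul, Matrix.smul_mul,
    (smul_right_injective _ (by norm_num : (1 / 2 : ℂ) ≠ 0)).eq_iff]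
  simp only [fromBlocks_multiply, fromBlocks_inj]
  simp only [mul_zero, zero_mul, mul_neg, neg_mul, zero_add, add_zero, neg_inj, neg_zero,
    true_and, and_true]
  refine and_iff_left_of_imp fun h => ?_
  simpa [mconj_mul, mconj_J] using congrArg mconj h

/-- The antilinear involution of `M_{2r}(ℂ)` whose fixed points are the matrices of
quaternionic type. -/
noncomputable def quatConj (a : Matrix (ι r) (ι r) ℂ) : Matrix (ι r) (ι r) ℂ :=
  -(J r * mconj a * J r)

variable {r}

lemma J_mul_J_mul (a : Matrix (ι r) (ι r) ℂ) : J r * (J r * a) = -a := by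
  rw [← mul_assoc, J_mul_J, neg_one_mul]

lemma commute_J_iff_quatConj {a : Matrix (ι r) (ι r) ℂ} :
    a * J r = J r * mconj a ↔ quatConj r a = a := by
  constructor
  · intro h
    rw [quatConj, ← h, mul_assoc, J_mul_J, mul_neg_one, neg_neg]
  · intro h
    conv_lhs => rw [← h]
    rw [quatConj, neg_mul, mul_assoc, J_mul_J, mul_neg_one, neg_neg]

lemma quatConj_mul (a b : Matrix (ι r) (ι r) ℂ) :
    quatConj r (a * b) = quatConj r a * quatConj r b := by
  simp only [quatConj, mconj_mul, neg_mul_neg, mul_assoc]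
  rw [J_mul_J_mul, mul_neg, mul_neg]

@[simp] lemma quatConj_quatConj (a : Matrix (ι r) (ι r) ℂ) : quatConj r (quatConj r a) = a := by
  have h : mconj (-(J r * mconj a * J r)) = -(J r * a * J r) := by
    have : ∀ b : Matrix (ι r) (ι r) ℂ, mconj (-b) = -mconj b := fun b => by ext; simp
    simp [this, mconj_mul, mconj_J]
  rw [quatConj, quatConj, h]
  simp only [mul_neg, neg_neg, mul_assoc, J_mul_J, J_mul_J_mul, mul_one]

lemma quatConj_one : quatConj r 1 = 1 :=
  commute_J_iff_quatConj.1 (by ext i j; simp [mconj, Matrix.map_one])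

lemma quatConj_add (a b : Matrix (ι r) (ι r) ℂ) :
    quatConj r (a + b) = quatConj r a + quatConj r b := by
  have h : mconj (a + b) = mconj a + mconj b := by ext; simp
  rw [quatConj, h, mul_add, add_mul, neg_add]; rfl

lemma quatConj_zero : quatConj r 0 = 0 := by
  have h : mconj (0 : Matrix (ι r) (ι r) ℂ) = 0 := by ext; simp
  simp [quatConj, h]

lemma quatConj_smul (z : ℂ) (a : Matrix (ι r) (ι r) ℂ) :
    quatConj r (z • a) = starRingEnd ℂ z • quatConj r a := by
  have h : mconj (z • a) = starRingEnd ℂ z • mconj a := by ext; simp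
  simp [quatConj, h]

lemma quatConj_star (a : Matrix (ι r) (ι r) ℂ) :
    quatConj r (star a) = star (quatConj r a) := by
  have h : mconj (star a) = aᵀ := by ext; simp
  have hJ : star (J r) = -J r := by
    have : star (J r) = (mconj (J r))ᵀ := by ext; simp
    rw [this, mconj_J, J_transpose]
  have h' : star (mconj a) = aᵀ := by ext; simp
  simp [quatConj, h, h', hJ, mul_assoc]

variable (r) in
/-- The unitary matrices of quaternionic type. -/
noncomputable def quatUnitary : Submonoid (Matrix (ι r) (ι r) ℂ) where
  carrier := {a | a ∈ unitaryGroup (ι r) ℂ ∧ a * J r = J r * mconj a}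
  one_mem' := ⟨one_mem _, commute_J_iff_quatConj.2 quatConj_one⟩
  mul_mem' ha hb := ⟨mul_mem ha.1 hb.1, commute_J_iff_quatConj.2 <| by
    rw [quatConj_mul, commute_J_iff_quatConj.1 ha.2, commute_J_iff_quatConj.1 hb.2]⟩

lemma mem_quatUnitary {a : Matrix (ι r) (ι r) ℂ} :
    a ∈ quatUnitary r ↔ a ∈ unitaryGroup (ι r) ℂ ∧ quatConj r a = a :=
  and_congr_right fun _ => commute_J_iff_quatConj

/-- The matrix acting as `z` on the range of `p`, as `conj z` on the range of the quaternionic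
conjugate of `p`, and trivially on the orthogonal complement. -/
noncomputable def quatRotation (p : Matrix (ι r) (ι r) ℂ) (z : ℂ) : Matrix (ι r) (ι r) ℂ :=
  1 + (z - 1) • p + (starRingEnd ℂ z - 1) • quatConj r p

@[simp] lemma quatRotation_one (p : Matrix (ι r) (ι r) ℂ) : quatRotation p 1 = 1 := by
  simp [quatRotation]

@[fun_prop] lemma continuous_quatRotation (p : Matrix (ι r) (ι r) ℂ) :
    Continuous (quatRotation p) := by
  unfold quatRotation
  have := Complex.continuous_conj
  fun_prop

lemma quatRotation_mem {p : Matrix (ι r) (ι r) ℂ} (hp : IsStarProjection p)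
    (hpq : p * quatConj r p = 0) {z : ℂ} (hz : ‖z‖ = 1) :
    quatRotation p z ∈ quatUnitary r := by
  have hp2 : p * p = p := hp.isIdempotentElem
  have hps : star p = p := hp.isSelfAdjoint
  have hq2 : quatConj r p * quatConj r p = quatConj r p := by rw [← quatConj_mul, hp2]
  have hqs : star (quatConj r p) = quatConj r p := by rw [← quatConj_star, hps]
  have hqp : quatConj r p * p = 0 := by
    simpa [star_mul, hps, hqs] using congrArg star hpq
  have hzz : z * starRingEnd ℂ z = 1 := by
    rw [Complex.mul_conj, Complex.normSq_eq_norm_sq, hz]; norm_num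
  rw [mem_quatUnitary, mem_unitaryGroup_iff]
  constructor
  · simp only [quatRotation, star_add, star_smul, star_sub, star_one, hps, hqs]
    simp only [add_mul, mul_add, smul_mul_assoc, mul_smul_comm, hp2, hq2, hpq, hqp, one_mul,
      mul_one, smul_zero, add_zero, ← starRingEnd_apply, Complex.conj_conj]
    match_scalars <;> first | ring1 | linear_combination hzz
  · simp only [quatRotation, quatConj_add, quatConj_smul, quatConj_one, quatConj_quatConj,
      map_sub, map_one, Complex.conj_conj]
    abel

open scoped Matrix.Norms.L2Operator in
lemma exists_eigenvector_of_mem_unitaryGroup {n : Type*} [Fintype n] [DecidableEq n]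
    {a : Matrix n n ℂ} (ha : a ∈ unitaryGroup n ℂ) (h1 : a ≠ 1) :
    ∃ z : ℂ, z ≠ 1 ∧ ‖z‖ = 1 ∧ ∃ v : n → ℂ, v ≠ 0 ∧ a *ᵥ v = z • v := by
  have hn : IsStarNormal a := ⟨by
    rw [Commute, SemiconjBy, mem_unitaryGroup_iff.1 ha, mem_unitaryGroup_iff'.1 ha]⟩
  obtain ⟨z, hz, hz1⟩ : ∃ z ∈ spectrum ℂ a, z ≠ 1 := by
    by_contra! h
    exact h1 (CFC.eq_one_of_spectrum_subset_one (R := ℂ) a h)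
  refine ⟨z, hz1, spectrum.norm_eq_one_of_unitary ha hz, ?_⟩
  rw [← spectrum_toLin', ← Module.End.hasEigenvalue_iff_mem_spectrum] at hz
  obtain ⟨v, hv⟩ := hz.exists_hasEigenvector
  exact ⟨v, hv.2, by simpa using hv.apply_eq_smul⟩

lemma dotProduct_J_mulVec_self (w : ι r → ℂ) : w ⬝ᵥ J r *ᵥ w = 0 := by
  have h : w ⬝ᵥ J r *ᵥ w = -(w ⬝ᵥ J r *ᵥ w) := by
    conv_lhs => rw [dotProduct_comm, ← vecMul_transpose, ← dotProduct_mulVec, J_transpose,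
      neg_mulVec, dotProduct_neg]
  exact self_eq_neg.1 h

open scoped ComplexOrder in
lemma exists_isStarProjection_of_ne_zero {v : ι r → ℂ} (hv : v ≠ 0) :
    ∃ p : Matrix (ι r) (ι r) ℂ, IsStarProjection p ∧ p * quatConj r p = 0 ∧ p *ᵥ v = v ∧
      ∀ (a : Matrix (ι r) (ι r) ℂ) (z : ℂ), a *ᵥ v = z • v → a * p = z • p := by
  have hc : star v ⬝ᵥ v ≠ 0 := by rwa [Ne, dotProduct_star_self_eq_zero]
  have hcs : star (star v ⬝ᵥ v) = star v ⬝ᵥ v :=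
    (star_dotProduct v v).symm
  refine ⟨(star v ⬝ᵥ v)⁻¹ • vecMulVec v (star v), ⟨?_, ?_⟩, ?_, ?_, fun a z h => ?_⟩
  · rw [IsIdempotentElem, Matrix.smul_mul, Matrix.mul_smul, vecMulVec_mul_vecMulVec, vecMulVec_smul,
      smul_smul, smul_smul, inv_mul_cancel_right₀ hc]
  · rw [IsSelfAdjoint, star_smul, star_inv₀, hcs, star_eq_conjTranspose, conjTranspose_vecMulVec,
      star_star]
  · have h : mconj (vecMulVec v (star v)) = vecMulVec (star v) v := by
      ext; simp [vecMulVec_apply]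
    have h' : vecMulVec v (star v) * quatConj r (vecMulVec v (star v)) = 0 := by
      rw [quatConj, h, mul_neg, mul_vecMulVec, ← mul_assoc, vecMulVec_mul_vecMulVec,
        dotProduct_J_mulVec_self]
      simp
    rw [quatConj_smul, Matrix.smul_mul, Matrix.mul_smul, h', smul_zero, smul_zero]
  · rw [smul_mulVec, vecMulVec_mulVec, op_smul_eq_smul, inv_smul_smul₀ hc]
  · rw [Matrix.mul_smul, mul_vecMulVec, h, smul_vecMulVec, smul_comm]

lemma mul_eq_smul_of_mem_unitaryGroup {n : Type*} [Fintype n] [DecidableEq n]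
    {a p : Matrix n n ℂ} (ha : a ∈ unitaryGroup n ℂ) (hp : IsSelfAdjoint p) {z : ℂ}
    (hz : ‖z‖ = 1) (h : a * p = z • p) : p * a = z • p := by
  have hzz : starRingEnd ℂ z * z = 1 := by
    rw [mul_comm, Complex.mul_conj, Complex.normSq_eq_norm_sq, hz]; norm_num
  have h1 : star a * p = starRingEnd ℂ z • p := by
    calc star a * p = (starRingEnd ℂ z * z) • (star a * p) := by rw [hzz, one_smul]
      _ = starRingEnd ℂ z • (star a * (a * p)) := by rw [h, mul_smul, Matrix.mul_smul]
      _ = starRingEnd ℂ z • p := by rw [← mul_assoc, mem_unitaryGroup_iff'.1 ha, one_mul]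
  simpa [star_mul, hp.star_eq] using congrArg star h1

lemma exists_joinedIn_quatUnitary {a : Matrix (ι r) (ι r) ℂ} (ha : a ∈ quatUnitary r)
    (h1 : a ≠ 1) :
    ∃ b, JoinedIn (quatUnitary r : Set (Matrix (ι r) (ι r) ℂ)) a b ∧
      LinearMap.ker (toLin' (a - 1)) < LinearMap.ker (toLin' (b - 1)) := by
  obtain ⟨hau, haq⟩ := mem_quatUnitary.1 ha
  obtain ⟨z, hz1, hz, v, hv, hav⟩ := exists_eigenvector_of_mem_unitaryGroup hau h1
  obtain ⟨p, hp, hpq, hpv, hap⟩ := exists_isStarProjection_of_ne_zero hv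
  replace hap := hap a z hav
  have hpa := mul_eq_smul_of_mem_unitaryGroup hau hp.isSelfAdjoint hz hap
  have hqa : quatConj r p * a = starRingEnd ℂ z • quatConj r p := by
    rw [← quatConj_smul, ← hpa, quatConj_mul, haq]
  have hqp : quatConj r p * p = 0 := by
    simpa [quatConj_mul, quatConj_zero] using congrArg (quatConj r) hpq
  have hzc : starRingEnd ℂ z ≠ 1 := fun h => hz1 (by simpa using congrArg (starRingEnd ℂ) h)
  have eq_zero {q : Matrix (ι r) (ι r) ℂ} {c : ℂ} (hc : c ≠ 1) (hq : q * a = c • q)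
      {w : ι r → ℂ} (hw : a *ᵥ w = w) : q *ᵥ w = 0 := by
    have h : q *ᵥ w = c • (q *ᵥ w) := by
      rw [← smul_mulVec, ← hq, ← mulVec_mulVec, hw]
    have h' : (1 - c) • (q *ᵥ w) = 0 := by rw [sub_smul, one_smul, ← h, sub_self]
    exact (smul_eq_zero.1 h').resolve_left (sub_ne_zero.2 hc.symm)
  have mem_ker (b : Matrix (ι r) (ι r) ℂ) (w : ι r → ℂ) :
      w ∈ LinearMap.ker (toLin' (b - 1)) ↔ b *ᵥ w = w := by
    rw [LinearMap.mem_ker, toLin'_apply, sub_mulVec, one_mulVec, sub_eq_zero]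
  refine ⟨a * quatRotation p (starRingEnd ℂ z), ?_, ?_⟩
  · refine JoinedIn.ofLine
      (f := fun t : ℝ => a * quatRotation p (Complex.exp (↑(-(t * z.arg)) * Complex.I)))
      (Continuous.continuousOn (by fun_prop)) (by simp) ?_ ?_
    · have h : Complex.exp (z.arg * Complex.I) = z := by
        simpa [hz] using Complex.norm_mul_exp_arg_mul_I z
      have h' : Complex.exp (↑(-(1 * z.arg)) * Complex.I) = starRingEnd ℂ z := by
        conv_rhs => rw [← h, ← Complex.exp_conj]
        simp
      simp only [h']
    · rintro _ ⟨t, -, rfl⟩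
      exact mul_mem ha (quatRotation_mem hp hpq (Complex.norm_exp_ofReal_mul_I _))
  · refine SetLike.lt_iff_le_and_exists.2 ⟨fun w hw => ?_, v, ?_, ?_⟩
    · rw [mem_ker] at hw ⊢
      rw [← mulVec_mulVec, quatRotation, add_mulVec, add_mulVec, smul_mulVec, smul_mulVec,
        eq_zero hz1 hpa hw, eq_zero hzc hqa hw, smul_zero, smul_zero, add_zero, add_zero,
        one_mulVec, hw]
    · have hqv : quatConj r p *ᵥ v = 0 := by rw [← hpv, mulVec_mulVec, hqp, zero_mulVec]
      have hzz : starRingEnd ℂ z * z = 1 := by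
        rw [mul_comm, Complex.mul_conj, Complex.normSq_eq_norm_sq, hz]; norm_num
      rw [mem_ker, ← mulVec_mulVec, quatRotation, add_mulVec, add_mulVec, smul_mulVec,
        smul_mulVec, hpv, hqv, one_mulVec, smul_zero, add_zero, sub_smul, one_smul,
        add_sub_cancel, mulVec_smul, hav, smul_smul, hzz, one_smul]
    · rw [mem_ker, hav]
      intro h
      have h' : (z - 1) • v = 0 := by rw [sub_smul, h, one_smul, sub_self]
      exact (smul_eq_zero.1 h').elim (sub_ne_zero.2 hz1) hv

lemma joinedIn_quatUnitary_one {a : Matrix (ι r) (ι r) ℂ} (ha : a ∈ quatUnitary r) :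
    JoinedIn (quatUnitary r : Set (Matrix (ι r) (ι r) ℂ)) a 1 := by
  induction hK : LinearMap.ker (toLin' (a - 1)) using WellFoundedGT.induction generalizing a with
  | ind K ih =>
    by_cases h1 : a = 1
    · subst h1
      exact JoinedIn.refl ha
    · obtain ⟨b, hab, hlt⟩ := exists_joinedIn_quatUnitary ha h1
      exact hab.trans (ih _ (hK ▸ hlt) hab.target_mem rfl)

variable (r) in
lemma isPathConnected_quatUnitary :
    IsPathConnected (quatUnitary r : Set (Matrix (ι r) (ι r) ℂ)) :=
  ⟨1, one_mem _, fun {_} ha => (joinedIn_quatUnitary_one ha).symm⟩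

end QuaternionicUnitary

/-- For `G* = SO*(4r) ⊆ SU_{2r,2r}(ℂ)` with maximal compact
subgroup `K* ≅ U_{2r}(ℂ)` realized as the block matrices `diag(a, a^{−⊤})`,
and the Euler element `h = (1/2)[[0,J],[−J,0]]`: an element `diag(a, a^{−⊤})`
with `a ∈ U_{2r}(ℂ)` commutes with `h` if and only if `aJ = J·conj(a)`; the
matrices satisfying `aJ = J·conj(a)` are exactly those of quaternionic block
form `[[α,β],[−conj β, conj α]]` (identifying them with `U_r(ℍ)`); and the set
of unitary such matrices is connected.  Hence `(K*)^h ≅ U_r(ℍ)` is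
connected. -/
theorem SOstar_centralizer_is_quaternionic_unitary_and_connected :
    (∀ a : Matrix (ι r) (ι r) ℂ, a ∈ Matrix.unitaryGroup (ι r) ℂ →
      ((Matrix.fromBlocks a 0 0 (a⁻¹).transpose) * hEuler r
          = hEuler r * (Matrix.fromBlocks a 0 0 (a⁻¹).transpose)
        ↔ a * J r = J r * mconj a)) ∧
    (∀ a : Matrix (ι r) (ι r) ℂ,
      (a * J r = J r * mconj a ↔
        ∃ α β : Matrix (Fin r) (Fin r) ℂ,
          a = Matrix.fromBlocks α β (-(mconj β)) (mconj α))) ∧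
    IsConnected {a : Matrix (ι r) (ι r) ℂ |
      a ∈ Matrix.unitaryGroup (ι r) ℂ ∧ a * J r = J r * mconj a} := by
  exact ⟨fun _ => commute_hEuler_iff r, commute_J_iff_fromBlocks r,
    (isPathConnected_quatUnitary r).isConnected⟩

end Stmt19
end
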